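/- Fix n ≥ 1. For τ ∈ S_n with τ ≠ id define f_τ : S_n → ℝ as follows: let j+1 be the smallest element of {1,…,n} with τ_{j+1} ≠ j+1 and let i be the index with τ_i = j+1; set f_τ(σ) = 1 if std(σ_{j+1},…,σ_n) = std(τ_{j+1},…,τ_n), f_τ(σ) = −1 if std(σ_{j+1},…,σ_n) = std(j+1, τ_{j+1},…,τ_{i−1}, τ_{i+1},…,τ_n), and f_τ(σ) = 0 otherwise; and let f_id be the constant function 1. Then the n! functions {f_τ : τ ∈ S_n} form a basis of the real vector space of all functions S_n → ℝ. -/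

import Mathlib

open scoped Classical

noncomputable section

/-- The standardisation (rank function) of a word `w = (w 0, …, w (m-1))` of distinct
letters from a linear order: position `a` is sent to the number of positions carrying a
smaller letter (so, `0`-indexed ranks). -/
def std {m : ℕ} {α : Type*} [LinearOrder α] (w : Fin m → α) : Fin m → Fin m :=
  fun a =>
    ⟨(Finset.univ.filter (fun b => w b < w a)).card, by
      have ha : a ∉ Finset.univ.filter (fun b => w b < w a) := by simp
      have h := Finset.card_lt_card
        ((Finset.ssubset_iff_of_subset (Finset.filter_subset _ _)).2
          ⟨a, Finset.mem_univ a, ha⟩)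
      simpa using h⟩

/-- `subMatch n r σ τ` says: the subsequence of the word `(τ 0, …, τ (n-1))` consisting of
the entries with values `≥ r` (`0`-indexed; these are the values `{r+1,…,n}` in `1`-indexed
notation) has the same standardisation as the word `(σ r, …, σ (n-1))`.
Here `g` is the (unique) strictly increasing enumeration of the relevant positions. -/
def subMatch (n r : ℕ) (σ τ : Equiv.Perm (Fin n)) : Prop :=
  ∃ g : Fin (n - r) → Fin n, StrictMono g ∧
    (∀ p : Fin n, (∃ a, g a = p) ↔ r ≤ (τ p : ℕ)) ∧
    std (fun a => τ (g a)) =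
      std (fun a : Fin (n - r) => σ ⟨r + (a : ℕ), by have := a.isLt; omega⟩)

/-- The top-to-random-with-standardisation transition matrix on `S_n`. -/
def Ktr (n : ℕ) : Matrix (Equiv.Perm (Fin n)) (Equiv.Perm (Fin n)) ℝ :=
  Matrix.of fun σ τ => if subMatch n 1 σ τ then 1 / (n : ℝ) else 0

/-- The binomial-top-to-random-with-standardisation transition matrix on `S_n`,
with parameter `q`. -/
def Kq (n : ℕ) (q : ℝ) : Matrix (Equiv.Perm (Fin n)) (Equiv.Perm (Fin n)) ℝ :=
  Matrix.of fun σ τ =>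
    ∑ r ∈ Finset.range (n + 1),
      ((1 - q) ^ r * q ^ (n - r) / (r.factorial : ℝ)) *
        (if subMatch n r σ τ then 1 else 0)

/-- The word `(σ_{j+1}, …, σ_n)` (0-indexed: the entries of `σ` at positions `j,…,n-1`). -/
def tailWord (n j : ℕ) (σ : Equiv.Perm (Fin n)) : Fin (n - j) → Fin n :=
  fun a => σ ⟨j + (a : ℕ), by have := a.isLt; omega⟩

/-- The word `(j+1, τ_{j+1}, …, τ_{i-1}, τ_{i+1}, …, τ_n)` (0-indexed: first letter the
value `j`, followed by the entries of `τ` at positions `j,…,n-1` skipping position `i`). -/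
def wMinus (n j : ℕ) (i : Fin n) (τ : Equiv.Perm (Fin n)) : Fin (n - j) → Fin n :=
  fun a =>
    if (a : ℕ) = 0 then ⟨j, by have := a.isLt; omega⟩
    else if j + (a : ℕ) - 1 < (i : ℕ) then τ ⟨j + (a : ℕ) - 1, by have := a.isLt; omega⟩
    else τ ⟨j + (a : ℕ), by have := a.isLt; omega⟩

/-- The eigenfunction `f_τ` attached to a non-identity permutation `τ`, where `j` is the
number of initial fixed points of `τ` and `i` is the position of the value `j` in `τ`. -/
def fTau (n j : ℕ) (i : Fin n) (τ σ : Equiv.Perm (Fin n)) : ℝ :=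
  if std (tailWord n j σ) = std (tailWord n j τ) then 1
  else if std (tailWord n j σ) = std (wMinus n j i τ) then -1
  else 0


/-- The full family of functions: `f_τ` for non-identity `τ` (with `j` the number of
initial fixed points of `τ` and `i = τ⁻¹ j`), and the constant function `1` for `τ = id`. -/
def fFull (n : ℕ) (τ : Equiv.Perm (Fin n)) : Equiv.Perm (Fin n) → ℝ :=
  if h : τ = 1 then fun _ => 1
  else
    have hne : (Finset.univ.filter fun m : Fin n => τ m ≠ m).Nonempty := by
      by_contra hc
      apply h
      apply Equiv.ext
      intro x
      by_contra hx
      exact hc ⟨x, Finset.mem_filter.2 ⟨Finset.mem_univ x,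
        fun he => hx (he.trans (Equiv.Perm.one_apply x).symm)⟩⟩
    fTau n ((Finset.univ.filter fun m : Fin n => τ m ≠ m).min' hne).val
      (τ.symm ((Finset.univ.filter fun m : Fin n => τ m ≠ m).min' hne)) τ

/-- Two words have the same relative order of letters. -/
def Pat {ι α β : Type*} [LT α] [LT β] (w : ι → α) (w' : ι → β) : Prop :=
  ∀ a b, w a < w b ↔ w' a < w' b

theorem Pat.symm {ι α β : Type*} [LT α] [LT β] {w : ι → α} {w' : ι → β} (h : Pat w w') :
    Pat w' w :=
  fun a b => (h a b).symm

theorem Pat.trans {ι α β γ : Type*} [LT α] [LT β] [LT γ] {w : ι → α} {w' : ι → β}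
    {w'' : ι → γ} (h : Pat w w') (h' : Pat w' w'') : Pat w w'' :=
  fun a b => (h a b).trans (h' a b)

theorem std_lt_std_iff {m : ℕ} {α : Type*} [LinearOrder α] (w : Fin m → α) (a b : Fin m) :
    std w a < std w b ↔ w a < w b := by
  have mono : ∀ a b, w a ≤ w b → std w a ≤ std w b := by
    intro a b hab
    refine Fin.mk_le_mk.2 (Finset.card_le_card fun c hc => ?_)
    simp only [Finset.mem_filter, Finset.mem_univ, true_and] at hc ⊢
    exact hc.trans_le hab
  refine ⟨fun h => lt_of_not_ge fun hba => (mono b a hba).not_gt h, fun h => ?_⟩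
  refine Fin.mk_lt_mk.2 (Finset.card_lt_card ?_)
  refine (Finset.ssubset_iff_of_subset fun c hc => ?_).2 ⟨a, ?_, ?_⟩
  · simp only [Finset.mem_filter, Finset.mem_univ, true_and] at hc ⊢
    exact hc.trans h
  · simpa using h
  · simp

theorem std_eq_std_iff {m : ℕ} {α β : Type*} [LinearOrder α] [LinearOrder β]
    (w : Fin m → α) (w' : Fin m → β) : std w = std w' ↔ Pat w w' := by
  constructor
  · intro h a b
    rw [← std_lt_std_iff w, h, std_lt_std_iff]
  · intro h
    funext a
    apply Fin.ext
    simp only [std]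
    congr 1
    ext b
    simp [h b a]

/-- Insert a new smallest letter at position `i`. -/
def insMin {m : ℕ} (i : Fin (m + 1)) (w : Fin m → ℕ) : Fin (m + 1) → ℕ :=
  Fin.insertNth (α := fun _ => ℕ) i 0 (fun a => w a + 1)

@[simp] theorem insMin_same {m : ℕ} (i : Fin (m + 1)) (w : Fin m → ℕ) : insMin i w i = 0 := by
  simp [insMin]

@[simp] theorem insMin_succAbove {m : ℕ} (i : Fin (m + 1)) (w : Fin m → ℕ) (a : Fin m) :
    insMin i w (i.succAbove a) = w a + 1 := by
  simp [insMin]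

theorem insMin_injective {m : ℕ} (i : Fin (m + 1)) {w : Fin m → ℕ} (hw : w.Injective) :
    (insMin i w).Injective := by
  intro a b
  induction a using Fin.succAboveCases i <;> induction b using Fin.succAboveCases i <;>
    simp [hw.eq_iff]

theorem pat_insMin_iff {m : ℕ} {β : Type*} [LinearOrder β] (q p : Fin (m + 1)) (w : Fin m → ℕ)
    (v : Fin (m + 1) → β) (hv : ∀ a, v p < v (p.succAbove a)) :
    Pat (insMin q w) v ↔ q = p ∧ Pat w (fun a => v (p.succAbove a)) := by
  constructor
  · intro h
    have hqp : q = p := by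
      by_contra hne
      obtain ⟨a, ha⟩ := Fin.exists_succAbove_eq (Ne.symm hne)
      obtain ⟨b, hb⟩ := Fin.exists_succAbove_eq hne
      have h1 : v q < v p := by
        rw [← h q p, ← ha]
        simp
      have h2 := hv b
      rw [hb] at h2
      exact lt_asymm h1 h2
    subst hqp
    refine ⟨rfl, fun a b => ?_⟩
    simpa using h (q.succAbove a) (q.succAbove b)
  · rintro ⟨rfl, h⟩ a b
    induction a using Fin.succAboveCases q with
    | x => induction b using Fin.succAboveCases q with
      | x => simp
      | p b => simp [hv b]
    | p a => induction b using Fin.succAboveCases q with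
      | x => simp [(hv a).le]
      | p b => simpa using h a b

theorem Pat.insMin {m : ℕ} {w w' : Fin m → ℕ} (h : Pat w w') (i : Fin (m + 1)) :
    Pat (insMin i w) (insMin i w') := by
  rw [pat_insMin_iff i i w _ (by simp)]
  exact ⟨rfl, fun a b => by simpa using h a b⟩

theorem tail_insMin_zero {m : ℕ} (w : Fin m → ℕ) :
    Fin.tail (insMin 0 w) = fun a => w a + 1 := by
  funext a
  exact insMin_succAbove 0 w a

theorem tail_insMin_succ {m : ℕ} (i : Fin (m + 1)) (w : Fin (m + 1) → ℕ) :
    Fin.tail (insMin i.succ w) = insMin i (Fin.tail w) := by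
  funext a
  induction a using Fin.succAboveCases i with
  | x => exact (insMin_same i.succ w).trans (insMin_same i _).symm
  | p a =>
    rw [insMin_succAbove, Fin.tail, ← Fin.succ_succAbove_succ, insMin_succAbove, Fin.tail]

/-- Inserting a new minimum everywhere and then dropping the first letter has only positive
eigenvalues on the functions of patterns. -/
theorem eq_zero_of_mul_add_sum_tail_insMin (m : ℕ) : ∀ (c : ℝ), 0 ≤ c →
    ∀ H : (Fin m → ℕ) → ℝ, (∀ w w', Pat w w' → H w = H w') →
    (∀ w, w.Injective → c * H w + ∑ i : Fin (m + 1), H (Fin.tail (insMin i w)) = 0) →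
    ∀ w, w.Injective → H w = 0 := by
  induction m with
  | zero =>
    intro c hc H _ hH w hw
    have h := hH w hw
    rw [Fin.sum_univ_one, Subsingleton.elim (Fin.tail _) w] at h
    have h' : (c + 1) * H w = 0 := by linarith
    exact (mul_eq_zero.1 h').resolve_left (by positivity)
  | succ m ih =>
    intro c hc H inv hH
    have step : ∀ w : Fin (m + 1) → ℕ, w.Injective →
        (c + 1) * H w + ∑ i : Fin (m + 1), H (insMin i (Fin.tail w)) = 0 := by
      intro w hw
      have h := hH w hw
      rw [Fin.sum_univ_succ, tail_insMin_zero] at h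
      simp only [tail_insMin_succ] at h
      rw [inv (fun a => w a + 1) w fun a b => by simp] at h
      linarith
    have hG : ∀ w : Fin m → ℕ, w.Injective → ∑ i : Fin (m + 1), H (insMin i w) = 0 := by
      refine ih (c + 1) (by positivity) (fun w => ∑ i : Fin (m + 1), H (insMin i w)) ?_ ?_
      · intro w w' h
        exact Finset.sum_congr rfl fun i _ => inv _ _ (h.insMin i)
      · intro w hw
        rw [Finset.mul_sum, ← Finset.sum_add_distrib]
        exact Finset.sum_eq_zero fun i _ => step _ (insMin_injective i hw)
    intro w hw
    have h := step w hw
    rw [hG (Fin.tail w) (hw.comp (Fin.succ_injective _)), add_zero] at h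
    exact (mul_eq_zero.1 h).resolve_left (by positivity)

/-- The last `m` letters of a permutation. -/
def lastWord {n : ℕ} (j m : ℕ) (h : j + m = n) (σ : Equiv.Perm (Fin n)) : Fin m → Fin n :=
  fun a => σ ⟨j + a, by omega⟩

theorem exists_perm_pat_lastWord {n j m : ℕ} (h : j + m = n) (w : Fin m → ℕ)
    (hw : w.Injective) : ∃ σ : Equiv.Perm (Fin n), Pat w (lastWord j m h σ) := by
  let v : Fin n → ℕ := fun a => if ha : j ≤ a then w ⟨a - j, by omega⟩ + n else a
  have hv : v.Injective := by
    intro a b hab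
    simp only [v] at hab
    split_ifs at hab with h1 h2 h2
    · have := hw (Nat.add_right_cancel hab)
      simp only [Fin.mk.injEq] at this
      omega
    · omega
    · omega
    · exact Fin.ext hab
  have hs : (std v).Injective := by
    intro a b hab
    apply hv
    by_contra hne
    rcases lt_or_gt_of_ne hne with h' | h'
    · exact ((std_lt_std_iff v a b).2 h').ne hab
    · exact ((std_lt_std_iff v b a).2 h').ne' hab
  refine ⟨Equiv.ofBijective _ (Finite.injective_iff_bijective.1 hs), fun a b => ?_⟩
  simp only [lastWord, Equiv.ofBijective_apply, std_lt_std_iff]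
  simp [v]

/-- The words formed by the letters at positions `≥ j` have the same pattern. -/
def TailPat {n : ℕ} (j : ℕ) (σ τ : Equiv.Perm (Fin n)) : Prop :=
  ∀ a b : Fin n, j ≤ a → j ≤ b → (σ a < σ b ↔ τ a < τ b)

theorem std_tailWord_eq_iff {n : ℕ} (j : ℕ) (σ τ : Equiv.Perm (Fin n)) :
    std (tailWord n j σ) = std (tailWord n j τ) ↔ TailPat j σ τ := by
  rw [std_eq_std_iff]
  constructor
  · intro h a b ha hb
    have := h ⟨a - j, by omega⟩ ⟨b - j, by omega⟩
    simpa only [tailWord, Nat.add_sub_cancel' ha, Nat.add_sub_cancel' hb] using this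
  · intro h a b
    exact h _ _ (Nat.le_add_right _ _) (Nat.le_add_right _ _)

theorem tailPat_iff_pat_lastWord {n j m : ℕ} (h : j + m = n) (σ τ : Equiv.Perm (Fin n)) :
    TailPat j σ τ ↔ Pat (lastWord j m h σ) (lastWord j m h τ) := by
  constructor
  · intro h a b
    exact h _ _ (Nat.le_add_right _ _) (Nat.le_add_right _ _)
  · intro h a b ha hb
    have := h ⟨a - j, by omega⟩ ⟨b - j, by omega⟩
    simpa only [lastWord, Nat.add_sub_cancel' ha, Nat.add_sub_cancel' hb] using this

/-- Every `k < j` is fixed by `τ` and `j` is not. -/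
def FirstMoved {n : ℕ} (j : Fin n) (τ : Equiv.Perm (Fin n)) : Prop :=
  (∀ k < j, τ k = k) ∧ τ j ≠ j

theorem exists_firstMoved {n : ℕ} {τ : Equiv.Perm (Fin n)} (h : τ ≠ 1) :
    ∃ j, FirstMoved j τ := by
  have hne : ∃ x, τ x ≠ x := by
    by_contra! hc
    exact h (Equiv.ext hc)
  obtain ⟨x, hx⟩ := hne
  obtain ⟨j, hj, hmin⟩ := WellFounded.has_min (wellFounded_lt (α := Fin n))
    {x | τ x ≠ x} ⟨x, hx⟩
  exact ⟨j, fun k hk => by_contra fun hne => hmin k hne hk, hj⟩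

theorem FirstMoved.ne_one {n : ℕ} {j : Fin n} {τ : Equiv.Perm (Fin n)} (h : FirstMoved j τ) :
    τ ≠ 1 := by
  rintro rfl
  exact h.2 rfl

theorem FirstMoved.fFull_eq {n : ℕ} {j : Fin n} {τ : Equiv.Perm (Fin n)}
    (h : FirstMoved j τ) : fFull n τ = fTau n j (τ.symm j) τ := by
  have hmin : ∀ hne, (Finset.univ.filter fun m : Fin n => τ m ≠ m).min' hne = j := by
    intro hne
    refine le_antisymm (Finset.min'_le _ _ (by simpa using h.2)) ?_
    refine Finset.le_min' _ _ _ fun k hk => ?_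
    by_contra! hlt
    simp only [Finset.mem_filter, Finset.mem_univ, true_and] at hk
    exact hk (h.1 k hlt)
  simp only [fFull, dif_neg h.ne_one, hmin]

theorem le_apply_of_fixed {n : ℕ} {j : Fin n} {τ : Equiv.Perm (Fin n)}
    (h : ∀ k < j, τ k = k) {a : Fin n} (ha : j ≤ a) : j ≤ τ a := by
  by_contra! hlt
  have := τ.injective (h _ hlt)
  exact absurd (this ▸ hlt) ha.not_gt

theorem eq_of_tailPat {n : ℕ} {j : Fin n} {σ τ : Equiv.Perm (Fin n)}
    (hσ : ∀ k < j, σ k = k) (hτ : ∀ k < j, τ k = k) (h : TailPat j σ τ) : σ = τ := by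
  have key : ∀ a b, σ a < σ b ↔ τ a < τ b := by
    intro a b
    rcases lt_or_ge a j with ha | ha <;> rcases lt_or_ge b j with hb | hb
    · rw [hσ a ha, hσ b hb, hτ a ha, hτ b hb]
    · rw [hσ a ha, hτ a ha]
      exact iff_of_true (ha.trans_le (le_apply_of_fixed hσ hb))
        (ha.trans_le (le_apply_of_fixed hτ hb))
    · rw [hσ b hb, hτ b hb]
      exact iff_of_false (hb.trans_le (le_apply_of_fixed hσ ha)).not_gt
        (hb.trans_le (le_apply_of_fixed hτ ha)).not_gt
    · exact h a b ha hb
  have hmono : StrictMono fun x => τ (σ.symm x) := by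
    intro x y hxy
    rw [← key]
    simpa using hxy
  have hid := hmono.eq_id
  ext a
  have := congrFun hid (σ a)
  simp only [Equiv.symm_apply_apply, id] at this
  rw [this]

theorem FirstMoved.lt_symm {n : ℕ} {j : Fin n} {τ : Equiv.Perm (Fin n)}
    (h : FirstMoved j τ) : j < τ.symm j := by
  by_contra! hle
  rcases hle.lt_or_eq with hlt | heq
  · have h1 := h.1 _ hlt
    rw [Equiv.apply_symm_apply] at h1
    exact hlt.ne h1.symm
  · exact h.2 ((Equiv.symm_apply_eq τ).1 heq).symm

theorem FirstMoved.lt_apply {n : ℕ} {j : Fin n} {τ : Equiv.Perm (Fin n)}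
    (h : FirstMoved j τ) {a : Fin n} (ha : j ≤ a) (hne : a ≠ τ.symm j) : j < τ a := by
  refine lt_of_le_of_ne (le_apply_of_fixed h.1 ha) fun heq => hne ?_
  rw [heq, Equiv.symm_apply_apply]

theorem FirstMoved.not_pat_wMinus {n : ℕ} {j : Fin n} {σ τ : Equiv.Perm (Fin n)}
    (hσ : FirstMoved j σ) (hτ : FirstMoved j τ) :
    ¬ Pat (tailWord n j σ) (wMinus n j (τ.symm j) τ) := by
  intro h
  have hlt := hσ.lt_symm
  have h1 := (h ⟨σ.symm j - j, by omega⟩ ⟨0, by omega⟩).1 (by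
    simp only [tailWord, Nat.add_sub_cancel' hlt.le, Nat.add_zero, Equiv.apply_symm_apply,
      Fin.eta]
    exact hσ.lt_apply le_rfl hlt.ne)
  have h0 : wMinus n j (τ.symm j) τ ⟨0, by omega⟩ = j := by simp [wMinus]
  rw [h0] at h1
  refine h1.not_ge ?_
  simp only [wMinus]
  split_ifs
  · exact le_rfl
  · exact le_apply_of_fixed hτ.1 (by rw [Fin.le_def]; dsimp only; omega)
  · exact le_apply_of_fixed hτ.1 (by rw [Fin.le_def]; dsimp only; omega)

theorem FirstMoved.fFull_apply {n : ℕ} {j : Fin n} {σ τ : Equiv.Perm (Fin n)}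
    (hσ : FirstMoved j σ) (hτ : FirstMoved j τ) :
    fFull n τ σ = if τ = σ then 1 else 0 := by
  rw [hτ.fFull_eq, fTau]
  simp only [std_tailWord_eq_iff]
  rw [if_neg (fun h => hσ.not_pat_wMinus hτ ((std_eq_std_iff _ _).1 h))]
  refine if_congr ⟨fun h => (eq_of_tailPat hσ.1 hτ.1 h).symm, ?_⟩ rfl rfl
  rintro rfl a b _ _
  rfl

theorem fFull_congr {n : ℕ} {j : Fin n} {σ σ' τ : Equiv.Perm (Fin n)}
    (hτ : ∀ k ≤ j, τ k = k) (h : TailPat (j + 1) σ σ') : fFull n τ σ = fFull n τ σ' := by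
  by_cases h1 : τ = 1
  · simp [fFull, h1]
  · obtain ⟨l, hl⟩ := exists_firstMoved h1
    have hjl : j < l := by
      by_contra! hle
      exact hl.2 (hτ l hle)
    have hs : std (tailWord n l σ) = std (tailWord n l σ') :=
      (std_tailWord_eq_iff _ _ _).2 fun a b ha hb =>
        h a b (by omega) (by omega)
    rw [hl.fFull_eq, fTau, fTau, hs]

theorem FirstMoved.fFull_insMin {n m : ℕ} {j : Fin n} (hm : (j : ℕ) + (m + 1) = n)
    {τ : Equiv.Perm (Fin n)} (hτ : FirstMoved j τ) :
    ∃ p : Fin (m + 1), p ≠ 0 ∧ ∃ Q : (Fin m → ℕ) → Prop, ∀ q w σ,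
      Pat (insMin q w) (lastWord j (m + 1) hm σ) →
      fFull n τ σ = if q = p ∧ Q w then 1 else if q = 0 ∧ Q w then -1 else 0 := by
  have hlt := hτ.lt_symm
  obtain ⟨p, hp⟩ : ∃ p : Fin (m + 1), (j : ℕ) + p = τ.symm j :=
    ⟨⟨τ.symm j - j, by omega⟩, by simp only; omega⟩
  have hpp : lastWord j (m + 1) hm τ p = j := by
    simp only [lastWord, hp, Fin.eta, Equiv.apply_symm_apply]
  have hpa : ∀ a : Fin m, j < lastWord j (m + 1) hm τ (p.succAbove a) := by
    intro a
    refine hτ.lt_apply (Fin.le_def.2 (Nat.le_add_right _ _)) fun heq => ?_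
    have h1 := congrArg Fin.val heq
    simp only [← hp] at h1
    exact Fin.succAbove_ne p a (Fin.ext (by omega))
  let v : Fin (m + 1) → Fin n :=
    Fin.cons j fun a : Fin m => lastWord j (m + 1) hm τ (p.succAbove a)
  have hv : ∀ a : Fin (m + 1), v a = wMinus n j (τ.symm j) τ ⟨a, by omega⟩ := by
    intro a
    induction a using Fin.cases with
    | zero => simp [v, wMinus]
    | succ a =>
      simp only [v, Fin.cons_succ, wMinus, lastWord, Fin.val_succ, Nat.succ_ne_zero, if_false,
        Fin.succAbove, Fin.lt_def, Fin.val_castSucc, ← hp, Nat.add_sub_cancel, ← Nat.add_assoc,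
        Nat.add_lt_add_iff_left]
      split_ifs <;> rfl
  refine ⟨p, fun h0 => ?_, fun w => Pat w fun a => lastWord j (m + 1) hm τ (p.succAbove a),
    fun q w σ hσ => ?_⟩
  · subst h0
    exact hlt.ne (Fin.ext (by simpa using hp))
  · rw [hτ.fFull_eq, fTau]
    refine if_congr ?_ rfl (if_congr ?_ rfl rfl)
    · rw [std_tailWord_eq_iff, tailPat_iff_pat_lastWord hm,
        ← pat_insMin_iff q p w _ (by rw [hpp]; exact hpa)]
      exact ⟨hσ.trans, hσ.symm.trans⟩
    · have hQ := pat_insMin_iff q 0 w v (by intro a; simpa [v] using hpa a)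
      simp only [Fin.zero_succAbove, v, Fin.cons_succ] at hQ
      rw [std_eq_std_iff, ← hQ]
      constructor
      · intro h
        refine hσ.trans fun a b => ?_
        have := h ⟨a, by omega⟩ ⟨b, by omega⟩
        rw [← hv a, ← hv b] at this
        exact this
      · intro h a b
        have := (hσ.symm.trans h) ⟨a, by omega⟩ ⟨b, by omega⟩
        change _ ↔ v _ < v _ at this
        rw [hv, hv] at this
        exact this

theorem FirstMoved.sum_fFull_insMin {n m : ℕ} {j : Fin n} (hm : (j : ℕ) + (m + 1) = n)
    {τ : Equiv.Perm (Fin n)} (hτ : FirstMoved j τ) (w : Fin m → ℕ)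
    (σ : Fin (m + 1) → Equiv.Perm (Fin n))
    (hσ : ∀ q, Pat (insMin q w) (lastWord j (m + 1) hm (σ q))) :
    ∑ q, fFull n τ (σ q) = 0 := by
  obtain ⟨p, hp, Q, hQ⟩ := hτ.fFull_insMin hm
  have h : ∀ q, fFull n τ (σ q) =
      (if q = p then if Q w then (1 : ℝ) else 0 else 0) -
        if q = 0 then if Q w then (1 : ℝ) else 0 else 0 := by
    intro q
    rw [hQ q w _ (hσ q)]
    by_cases hq : q = p
    · subst hq
      by_cases hw : Q w <;> simp [hw, hp]
    · by_cases hq0 : q = 0 <;> by_cases hw : Q w <;> simp [hq, hq0, hw, Ne.symm hp]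
  simp [h, Finset.sum_sub_distrib]

/-- A function of the pattern of the last letters that is, up to sign, a combination of the
`f_τ` with first moved point `j` vanishes. -/
theorem eq_zero_of_tailPat_of_sum {n : ℕ} (j : Fin n) (c : Equiv.Perm (Fin n) → ℝ)
    (F : Equiv.Perm (Fin n) → ℝ) (hF : ∀ σ σ', TailPat (j + 1) σ σ' → F σ = F σ')
    (hsum : ∀ σ, ∑ τ with FirstMoved j τ, c τ * fFull n τ σ + F σ = 0)
    (σ : Equiv.Perm (Fin n)) : F σ = 0 := by
  obtain ⟨m, hm⟩ : ∃ m, (j : ℕ) + (m + 1) = n := ⟨n - j - 1, by omega⟩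
  have hm' : (j : ℕ) + 1 + m = n := by omega
  let H : (Fin m → ℕ) → ℝ := fun w =>
    if h : ∃ ρ, Pat w (lastWord (j + 1) m hm' ρ) then F h.choose else 0
  have hH : ∀ w ρ, Pat w (lastWord (j + 1) m hm' ρ) → H w = F ρ := by
    intro w ρ h
    have hex : ∃ ρ, Pat w (lastWord (j + 1) m hm' ρ) := ⟨ρ, h⟩
    simp only [H, dif_pos hex]
    exact hF _ _ ((tailPat_iff_pat_lastWord hm' _ _).2 (hex.choose_spec.symm.trans h))
  have hinv : ∀ w w', Pat w w' → H w = H w' := by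
    intro w w' h
    by_cases hex : ∃ ρ, Pat w (lastWord (j + 1) m hm' ρ)
    · obtain ⟨ρ, hρ⟩ := hex
      rw [hH w ρ hρ, hH w' ρ (h.symm.trans hρ)]
    · have hex' : ¬ ∃ ρ, Pat w' (lastWord (j + 1) m hm' ρ) :=
        fun ⟨ρ, hρ⟩ => hex ⟨ρ, h.trans hρ⟩
      simp only [H, dif_neg hex, dif_neg hex']
  have hzero := eq_zero_of_mul_add_sum_tail_insMin m 0 le_rfl H hinv (by
    intro w hw
    choose ρ hρ using fun q => exists_perm_pat_lastWord hm (insMin q w) (insMin_injective q hw)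
    have h1 : ∀ q, H (Fin.tail (insMin q w)) =
        -∑ τ with FirstMoved j τ, c τ * fFull n τ (ρ q) := by
      intro q
      rw [hH _ (ρ q), eq_neg_iff_add_eq_zero, add_comm, hsum]
      intro a b
      have := hρ q a.succ b.succ
      simpa only [lastWord, Fin.val_succ, Nat.add_assoc, Nat.add_comm 1, Fin.tail] using this
    simp only [h1, Finset.sum_neg_distrib]
    rw [Finset.sum_comm, Finset.sum_eq_zero]
    · simp
    · intro τ hτ
      rw [← Finset.mul_sum, (Finset.mem_filter.1 hτ).2.sum_fFull_insMin hm w ρ hρ, mul_zero])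
  rw [← hH (fun a => (lastWord (j + 1) m hm' σ a : ℕ)) σ fun a b => Iff.rfl]
  apply hzero
  intro a b hab
  have := σ.injective (Fin.ext hab)
  simp only [Fin.mk.injEq] at this
  omega

theorem linearIndependent_fFull (n : ℕ) : LinearIndependent ℝ (fFull n) := by
  rw [Fintype.linearIndependent_iff]
  intro c hc
  have hc' : ∀ σ, ∑ τ, c τ * fFull n τ σ = 0 := by
    intro σ
    simpa [Finset.sum_apply] using congrFun hc σ
  have hmoved : ∀ j : Fin n, ∀ τ, FirstMoved j τ → c τ = 0 := by
    intro j
    induction j using WellFoundedLT.induction with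
    | ind j ih =>
      have hsplit : ∀ σ, ∑ τ with FirstMoved j τ, c τ * fFull n τ σ +
          ∑ τ with ∀ k ≤ j, τ k = k, c τ * fFull n τ σ = 0 := by
        intro σ
        rw [← hc' σ, Finset.sum_filter, Finset.sum_filter, ← Finset.sum_add_distrib]
        refine Finset.sum_congr rfl fun τ _ => ?_
        by_cases hfix : ∀ k ≤ j, τ k = k
        · have hn : ¬ FirstMoved j τ := fun h => h.2 (hfix j le_rfl)
          rw [if_neg hn, if_pos hfix, zero_add]
        · by_cases hj : FirstMoved j τ
          · rw [if_pos hj, if_neg hfix, add_zero]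
          · have h1 : τ ≠ 1 := by
              rintro rfl
              exact hfix fun k _ => rfl
            obtain ⟨l, hl⟩ := exists_firstMoved h1
            have hlj : l < j := by
              rcases lt_trichotomy l j with h | h | h
              · exact h
              · exact absurd (h ▸ hl) hj
              · exact absurd (fun k hk => hl.1 k (lt_of_le_of_lt hk h)) hfix
            rw [if_neg hj, if_neg hfix, ih l hlj τ hl]
            simp
      intro σ hσ
      have h0 := eq_zero_of_tailPat_of_sum j c
        (fun σ => ∑ τ with ∀ k ≤ j, τ k = k, c τ * fFull n τ σ)
        (fun σ σ' h => Finset.sum_congr rfl fun τ hτ => by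
          rw [fFull_congr (Finset.mem_filter.1 hτ).2 h]) hsplit σ
      have h1 := hsplit σ
      rw [h0, add_zero, Finset.sum_congr rfl fun τ hτ => by
        rw [hσ.fFull_apply (Finset.mem_filter.1 hτ).2]] at h1
      simpa [hσ] using h1
  have hne : ∀ τ, τ ≠ 1 → c τ = 0 := fun τ hτ =>
    let ⟨j, hj⟩ := exists_firstMoved hτ
    hmoved j τ hj
  intro τ
  by_cases hτ : τ = 1
  · subst hτ
    have h := hc' 1
    rw [Finset.sum_eq_single 1 (fun τ _ hτ => by rw [hne τ hτ, zero_mul]) (by simp)] at h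
    simpa [fFull] using h
  · exact hne τ hτ

/-- **The `n!` functions `{f_τ : τ ∈ S_n}` form a basis of the real vector space of all
functions `S_n → ℝ`** (they are linearly independent and span). -/
theorem fTau_family_is_basis (n : ℕ) (hn : 1 ≤ n) :
    LinearIndependent ℝ (fFull n) ∧
    Submodule.span ℝ (Set.range (fFull n)) = ⊤ := by
  refine ⟨linearIndependent_fFull n, ?_⟩
  apply (linearIndependent_fFull n).span_eq_top_of_card_eq_finrank
  rw [Module.finrank_fintype_fun_eq_card]

end
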